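/- arXiv:0810.1694 — 3 statements merged into one kernel-verified Lean document; each statement's English description precedes it below -/
import Mathlib

section
/- Let X be a real Banach space and let T and S be one-parameter semigroups of bounded linear operators on X satisfying the exponential bounds ‖T(h)‖ ≤ M_T·e^{ω_T h} and ‖S(h)‖ ≤ M_S·e^{ω_S h} for all h ≥ 0, where M_T, M_S ≥ 1 and ω_T, ω_S ∈ ℝ. Assume there exist constants M ≥ 1 and ω ∈ ℝ such that ‖(S(t/n)T(t/n))^n‖ ≤ M·e^{ωt} for all t ≥ 0 and all positive integers n. Then there exist constants M₃ ≥ 1 and ω₃ ∈ ℝ such that ‖(S(t/(2n))T(t/n)S(t/(2n)))^n‖ ≤ M₃·e^{ω₃ t} for all t ≥ 0 and all positive integers n. -/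
theorem mul_mul_pow_succ_eq {R : Type*} [Monoid R] (a b : R) (n : ℕ) :
    (a * b * a) ^ (n + 1) = a * b * (a * a * b) ^ n * a := by
  induction n with
  | zero => simp
  | succ n ih =>
    rw [pow_succ, ih, pow_succ (a * a * b)]
    simp only [mul_assoc]

theorem mul_exp_le_mul_exp_abs {C w x t : ℝ} (hC : 0 ≤ C) (hx : 0 ≤ x) (hxt : x ≤ t) :
    C * Real.exp (w * x) ≤ C * Real.exp (|w| * t) := by
  have h : w * x ≤ |w| * t :=
    mul_le_mul (le_abs_self w) hxt hx (abs_nonneg w)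
  gcongr

/-- Stability of the sequential splitting implies stability of the Strang-type
splitting `S(t/2n) T(t/n) S(t/2n)`. -/
theorem stmt_2 {X : Type*} [NormedAddCommGroup X] [NormedSpace ℝ X] [CompleteSpace X]
    (T S : ℝ → X →L[ℝ] X)
    (hT0 : T 0 = 1) (hTadd : ∀ s t : ℝ, 0 ≤ s → 0 ≤ t → T (s + t) = T s * T t)
    (hS0 : S 0 = 1) (hSadd : ∀ s t : ℝ, 0 ≤ s → 0 ≤ t → S (s + t) = S s * S t)
    (M_T M_S ω_T ω_S : ℝ) (hMT : 1 ≤ M_T) (hMS : 1 ≤ M_S)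
    (hTbound : ∀ h : ℝ, 0 ≤ h → ‖T h‖ ≤ M_T * Real.exp (ω_T * h))
    (hSbound : ∀ h : ℝ, 0 ≤ h → ‖S h‖ ≤ M_S * Real.exp (ω_S * h))
    (M ω : ℝ) (hM : 1 ≤ M)
    (hstab : ∀ t : ℝ, 0 ≤ t → ∀ n : ℕ, 0 < n →
      ‖(S (t / n) * T (t / n)) ^ n‖ ≤ M * Real.exp (ω * t)) :
    ∃ M₃ ω₃ : ℝ, 1 ≤ M₃ ∧ ∀ t : ℝ, 0 ≤ t → ∀ n : ℕ, 0 < n →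
      ‖(S (t / (2 * n)) * T (t / n) * S (t / (2 * n))) ^ n‖ ≤ M₃ * Real.exp (ω₃ * t) := by
  refine ⟨M_S * M_T * M * M_S, |ω_S| + |ω_T| + |ω| + |ω_S|,
    one_le_mul_of_one_le_of_one_le (one_le_mul_of_one_le_of_one_le
      (one_le_mul_of_one_le_of_one_le hMS hMT) hM) hMS, ?_⟩
  intro t ht n hn
  obtain ⟨k, rfl⟩ := Nat.exists_eq_succ_of_ne_zero hn.ne'
  set h : ℝ := t / (k.succ : ℕ) with hh
  have hk : (0 : ℝ) < (k.succ : ℕ) := by positivity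
  have hnh : t = (k + 1) * h := by
    rw [hh]; push_cast; field_simp
  have h0 : 0 ≤ h := by positivity
  have hkh : 0 ≤ k * h := by positivity
  have hhalf : t / (2 * (k.succ : ℕ)) = h / 2 := by
    rw [hh, div_div, mul_comm]
  have hSS : S (h / 2) * S (h / 2) = S h := by
    rw [← hSadd _ _ (by positivity) (by positivity), add_halves]
  have hS : ‖S (h / 2)‖ ≤ M_S * Real.exp (|ω_S| * t) :=
    (hSbound _ (by positivity)).trans
      (mul_exp_le_mul_exp_abs (by linarith) (by positivity) (by linarith))
  have hT : ‖T h‖ ≤ M_T * Real.exp (|ω_T| * t) :=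
    (hTbound _ h0).trans (mul_exp_le_mul_exp_abs (by linarith) h0 (by linarith))
  have hST : ‖(S h * T h) ^ k‖ ≤ M * Real.exp (|ω| * t) := by
    rcases Nat.eq_zero_or_pos k with hk0 | hk0
    · have h1 : 1 ≤ Real.exp (|ω| * t) := Real.one_le_exp (by positivity)
      rw [hk0, pow_zero]
      exact ContinuousLinearMap.norm_id_le.trans (one_le_mul_of_one_le_of_one_le hM h1)
    · have hb := hstab (k * h) hkh k hk0
      rw [mul_div_cancel_left₀ h (by positivity)] at hb
      exact hb.trans (mul_exp_le_mul_exp_abs (by linarith) hkh (by linarith))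
  rw [hhalf, Nat.succ_eq_add_one, mul_mul_pow_succ_eq, hSS]
  calc ‖S (h / 2) * T h * (S h * T h) ^ k * S (h / 2)‖
      ≤ ‖S (h / 2)‖ * ‖T h‖ * ‖(S h * T h) ^ k‖ * ‖S (h / 2)‖ :=
        norm_mul_le_of_le (norm_mul_le_of_le (norm_mul_le _ _) le_rfl) le_rfl
    _ ≤ M_S * Real.exp (|ω_S| * t) * (M_T * Real.exp (|ω_T| * t)) *
          (M * Real.exp (|ω| * t)) * (M_S * Real.exp (|ω_S| * t)) := by
        gcongr
    _ = M_S * M_T * M * M_S * Real.exp ((|ω_S| + |ω_T| + |ω| + |ω_S|) * t) := by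
        simp only [add_mul, Real.exp_add]
        ring
end

section
/- Let X be a real Banach space and let T, S : [0,∞) → B(X) be families of bounded linear operators on X. Assume there is a constant C such that ‖S(h)‖ ≤ C and ‖T(h)‖ ≤ C for all h ∈ [0,1], and that S(h)z → z and T(h)z → z as h → 0⁺ for every z ∈ X. Let x, a, b ∈ X be such that (T(h)x − x)/h → a and (S(h)x − x)/h → b as h → 0⁺. Then the Strang splitting operator is consistent at x: (T(h/2)S(h)T(h/2)x − x)/h → a + b as h → 0⁺. -/
open Filter Topology

/-- An eventually uniformly bounded family of operators that converges strongly at `z` also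
converges along every family of vectors tending to `z`. -/
theorem tendsto_clm_apply_of_eventually_norm_le {ι X Y : Type*}
    [NormedAddCommGroup X] [NormedSpace ℝ X] [NormedAddCommGroup Y] [NormedSpace ℝ Y]
    {l : Filter ι} {A : ι → X →L[ℝ] Y} {C : ℝ} {u : ι → X} {z : X} {w : Y}
    (hA : ∀ᶠ i in l, ‖A i‖ ≤ C) (hz : Tendsto (fun i => A i z) l (𝓝 w))
    (hu : Tendsto u l (𝓝 z)) : Tendsto (fun i => A i (u i)) l (𝓝 w) := by
  have hdiff : Tendsto (fun i => A i (u i - z)) l (𝓝 0) := by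
    refine squeeze_zero_norm' (a := fun i => C * ‖u i - z‖) ?_ ?_
    · filter_upwards [hA] with i hi
      exact (A i).le_of_opNorm_le hi _
    · simpa using (tendsto_iff_norm_sub_tendsto_zero.1 hu).const_mul C
  simpa using hdiff.add hz

/-- Consistency of the Strang splitting operator `T(h/2)S(h)T(h/2)` at a point `x`. -/
theorem stmt_8 {X : Type*} [NormedAddCommGroup X] [NormedSpace ℝ X] [CompleteSpace X]
    (T S : ℝ → X →L[ℝ] X) (C : ℝ)
    (hSbound : ∀ h : ℝ, h ∈ Set.Icc (0 : ℝ) 1 → ‖S h‖ ≤ C)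
    (hTbound : ∀ h : ℝ, h ∈ Set.Icc (0 : ℝ) 1 → ‖T h‖ ≤ C)
    (hScont : ∀ z : X, Tendsto (fun h : ℝ => S h z) (𝓝[>] 0) (𝓝 z))
    (hTcont : ∀ z : X, Tendsto (fun h : ℝ => T h z) (𝓝[>] 0) (𝓝 z))
    (x a b : X)
    (hTx : Tendsto (fun h : ℝ => h⁻¹ • (T h x - x)) (𝓝[>] 0) (𝓝 a))
    (hSx : Tendsto (fun h : ℝ => h⁻¹ • (S h x - x)) (𝓝[>] 0) (𝓝 b)) :
    Tendsto (fun h : ℝ => h⁻¹ • (T (h / 2) (S h (T (h / 2) x)) - x)) (𝓝[>] 0)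
      (𝓝 (a + b)) := by
  have hhalf : Tendsto (fun h : ℝ => h / 2) (𝓝[>] 0) (𝓝[>] 0) := by
    refine tendsto_nhdsWithin_iff.2 ⟨?_, ?_⟩
    · simpa using (tendsto_id.mono_left nhdsWithin_le_nhds :
        Tendsto (fun h : ℝ => h) (𝓝[>] 0) (𝓝 0)).div_const 2
    · filter_upwards [self_mem_nhdsWithin] with h hh
      exact half_pos (Set.mem_Ioi.1 hh)
  have hmem : ∀ᶠ h : ℝ in 𝓝[>] 0, h ∈ Set.Icc (0 : ℝ) 1 :=
    Icc_mem_nhdsGT zero_lt_one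
  have hS : ∀ᶠ h : ℝ in 𝓝[>] 0, ‖S h‖ ≤ C := hmem.mono hSbound
  have hT : ∀ᶠ h : ℝ in 𝓝[>] 0, ‖T (h / 2)‖ ≤ C := hhalf.eventually (hmem.mono hTbound)
  have hTz (z : X) : Tendsto (fun h : ℝ => T (h / 2) z) (𝓝[>] 0) (𝓝 z) :=
    (hTcont z).comp hhalf
  have hTx_half : Tendsto (fun h : ℝ => h⁻¹ • (T (h / 2) x - x)) (𝓝[>] 0)
      (𝓝 ((2⁻¹ : ℝ) • a)) := by
    refine ((hTx.comp hhalf).const_smul (2⁻¹ : ℝ)).congr fun h => ?_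
    simp [smul_smul, div_eq_mul_inv]
  have hTSTx := tendsto_clm_apply_of_eventually_norm_le hT (hTz _)
    (tendsto_clm_apply_of_eventually_norm_le hS (hScont _) hTx_half)
  have hTSx := tendsto_clm_apply_of_eventually_norm_le hT (hTz b) hSx
  have hlim : (2⁻¹ : ℝ) • a + b + (2⁻¹ : ℝ) • a = a + b := by module
  rw [← hlim]
  refine ((hTSTx.add hTSx).add hTx_half).congr fun h => ?_
  simp only [map_smul, map_sub, ← smul_add]
  congr 1
  abel
end

section
/- Let X be a real Banach space, t₀ > 0, t ∈ (0, t₀] fixed, and for each m ∈ ℕ let X_m be a real Banach space with bounded linear operators P_m : X → X_m and J_m : X_m → X satisfying P_m∘J_m = id_{X_m}, ‖P_m‖ ≤ M_P, ‖J_m‖ ≤ M_J for constants M_P, M_J > 0. Let T_m, S_m : [0, t₀] → B(X_m) be families of bounded linear operators with ‖S_m(s)‖ ≤ M_S·e^{ω_S s} for all s ∈ [0, t₀] and all m (with M_S ≥ 1, ω_S ∈ ℝ), and let S : [0, t₀] → B(X) be a family of bounded linear operators such that S(h)z → z as h → 0⁺ for every z ∈ X and, for every z ∈ X, sup_{s ∈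 [0,t₀]} ‖J_m S_m(s) P_m z − S(s)z‖ → 0 as m → ∞. Let x, a, b ∈ X be such that the joint limits lim_{n,m→∞} (n/t)·(J_m T_m(t/n) P_m x − J_m P_m x) = a and lim_{n,m→∞} (n/t)·(J_m S_m(t/n) P_m x − J_m P_m x) = b hold. Then the sequential splitting with spatial approximation is consistent at x: the joint limit lim_{n,m→∞} (n/t)·(J_m S_m(t/n) T_m(t/n) P_m x − J_m P_m x) = a + b holds. -/
open Filter Topology

/-- Consistency of the sequential splitting with spatial approximation: if the
approximate difference quotients of `T_m` and `S_m` at `x` have joint limits `a`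
and `b`, then the sequential splitting operator `S_m(t/n)T_m(t/n)` has joint
difference-quotient limit `a + b` at `x`. -/
theorem stmt_19 {X : Type*} [NormedAddCommGroup X] [NormedSpace ℝ X] [CompleteSpace X]
    (t₀ : ℝ) (ht₀ : 0 < t₀) (t : ℝ) (ht : t ∈ Set.Ioc (0 : ℝ) t₀)
    (Xm : ℕ → Type*) [∀ m, NormedAddCommGroup (Xm m)] [∀ m, NormedSpace ℝ (Xm m)]
    [∀ m, CompleteSpace (Xm m)]
    (P : ∀ m, X →L[ℝ] Xm m) (J : ∀ m, Xm m →L[ℝ] X)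
    (M_P M_J : ℝ) (hMP : 0 < M_P) (hMJ : 0 < M_J)
    (hPJ : ∀ (m : ℕ) (z : Xm m), P m (J m z) = z)
    (hPnorm : ∀ m : ℕ, ‖P m‖ ≤ M_P) (hJnorm : ∀ m : ℕ, ‖J m‖ ≤ M_J)
    (Tm : ∀ m : ℕ, ℝ → (Xm m →L[ℝ] Xm m)) (Sm : ∀ m : ℕ, ℝ → (Xm m →L[ℝ] Xm m))
    (M_S ω_S : ℝ) (hMS : 1 ≤ M_S)
    (hSmbound : ∀ m : ℕ, ∀ s ∈ Set.Icc (0 : ℝ) t₀, ‖Sm m s‖ ≤ M_S * Real.exp (ω_S * s))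
    (S : ℝ → X →L[ℝ] X)
    (hScont : ∀ z : X, Tendsto (fun h : ℝ => S h z) (𝓝[>] 0) (𝓝 z))
    (hSconv : ∀ z : X, ∀ ε > (0 : ℝ), ∃ M : ℕ, ∀ m ≥ M, ∀ s ∈ Set.Icc (0 : ℝ) t₀,
      ‖J m (Sm m s (P m z)) - S s z‖ ≤ ε)
    (x a b : X)
    (hTlim : ∀ ε > (0 : ℝ), ∃ N : ℕ, ∀ n m : ℕ, N ≤ n → N ≤ m →
      ‖((n : ℝ) / t) • (J m (Tm m (t / n) (P m x)) - J m (P m x)) - a‖ ≤ ε)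
    (hSlim : ∀ ε > (0 : ℝ), ∃ N : ℕ, ∀ n m : ℕ, N ≤ n → N ≤ m →
      ‖((n : ℝ) / t) • (J m (Sm m (t / n) (P m x)) - J m (P m x)) - b‖ ≤ ε) :
    ∀ ε > (0 : ℝ), ∃ N : ℕ, ∀ n m : ℕ, N ≤ n → N ≤ m →
      ‖((n : ℝ) / t) • (J m (Sm m (t / n) (Tm m (t / n) (P m x))) - J m (P m x)) -
        (a + b)‖ ≤ ε := by
  intro ε hε
  obtain ⟨ht_pos, ht_le⟩ := ht
  set K : ℝ := M_J * (M_S * Real.exp (|ω_S| * t₀) * M_P) with hK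
  have hK_pos : 0 < K := by positivity
  obtain ⟨N₁, hN₁⟩ := hTlim (ε / (4 * K)) (by positivity)
  obtain ⟨N₂, hN₂⟩ := hSlim (ε / 4) (by positivity)
  obtain ⟨N₃, hN₃⟩ := hSconv a (ε / 4) (by positivity)
  have h_step : Tendsto (fun n : ℕ => t / (n : ℝ)) atTop (𝓝[>] 0) := by
    refine tendsto_nhdsWithin_iff.2 ⟨tendsto_const_div_atTop_nhds_zero_nat t, ?_⟩
    filter_upwards [eventually_gt_atTop 0] with n hn
    exact div_pos ht_pos (Nat.cast_pos.2 hn)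
  obtain ⟨N₄, hN₄⟩ := Metric.tendsto_atTop.1 ((hScont a).comp h_step) (ε / 4) (by positivity)
  refine ⟨N₁ + N₂ + N₃ + N₄ + 1, fun n m hn hm => ?_⟩
  have hT := hN₁ n m (by lia) (by lia)
  have hS := hN₂ n m (by lia) (by lia)
  have hn_one : (1 : ℝ) ≤ n := by exact_mod_cast (show 1 ≤ n by lia)
  have h_mem : t / (n : ℝ) ∈ Set.Icc (0 : ℝ) t₀ :=
    ⟨by positivity, (div_le_self ht_pos.le hn_one).trans ht_le⟩
  have hA := hN₃ m (by lia) _ h_mem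
  have hB : ‖S (t / n) a - a‖ ≤ ε / 4 := by
    simpa [dist_eq_norm] using (hN₄ n (by lia)).le
  set h : ℝ := t / n
  set c : ℝ := n / t
  set d : X := c • (J m (Tm m h (P m x)) - J m (P m x)) with hd
  have h_bound (z : X) : ‖J m (Sm m h (P m z))‖ ≤ K * ‖z‖ := by
    have h_exp : ‖Sm m h‖ ≤ M_S * Real.exp (|ω_S| * t₀) := by
      refine (hSmbound m h h_mem).trans ?_
      have : ω_S * h ≤ |ω_S| * t₀ :=
        mul_le_mul (le_abs_self _) h_mem.2 h_mem.1 (abs_nonneg _)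
      gcongr
    calc ‖J m (Sm m h (P m z))‖ ≤ M_J * ‖Sm m h (P m z)‖ := (J m).le_of_opNorm_le (hJnorm m) _
      _ ≤ M_J * (M_S * Real.exp (|ω_S| * t₀) * ‖P m z‖) := by
        gcongr
        exact (Sm m h).le_of_opNorm_le h_exp _
      _ ≤ M_J * (M_S * Real.exp (|ω_S| * t₀) * (M_P * ‖z‖)) := by
        gcongr
        exact (P m).le_of_opNorm_le (hPnorm m) _
      _ = K * ‖z‖ := by rw [hK]; ring
  have hD : ‖J m (Sm m h (P m (d - a)))‖ ≤ ε / 4 := by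
    calc _ ≤ K * ‖d - a‖ := h_bound _
      _ ≤ K * (ε / (4 * K)) := by gcongr
      _ = ε / 4 := by field_simp
  have h_split : c • (J m (Sm m h (Tm m h (P m x))) - J m (P m x)) - (a + b) =
      J m (Sm m h (P m (d - a))) + (J m (Sm m h (P m a)) - S h a) + (S h a - a) +
        (c • (J m (Sm m h (P m x)) - J m (P m x)) - b) := by
    simp only [hd, map_sub, map_smul, hPJ, smul_sub]
    abel
  rw [h_split]
  refine norm_add₄_le.trans ?_
  linarith
end
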